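/- Let A be a finite abelian group and B a subgroup of index 2. The number of inverse-closed subsets S of A \ B with ⟨S⟩ a proper subgroup of A is at most 2^(|A|/8 + |A₂ \ B|/2 + log₂|A|). -/

import Mathlib

open Classical in
theorem aux_half {A : Type*} [CommGroup A] (f : A → ℕ) (hf : Function.Injective f)
    (T : Finset A) (hT : ∀ x ∈ T, x⁻¹ ∈ T) :
    2 * (T.filter (fun x => f x ≤ f x⁻¹)).card = T.card + (T.filter (fun x => x ^ 2 = 1)).card := by
  have h1 := Finset.card_filter_add_card_filter_not (s := T) (fun x => f x ≤ f x⁻¹)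
  have h2 : (T.filter (fun x => ¬ f x ≤ f x⁻¹)).card = (T.filter (fun x => f x < f x⁻¹)).card := by
    apply Finset.card_bij (fun x _ => x⁻¹)
    · intro x hx
      simp only [Finset.mem_filter, inv_inv, not_le] at hx ⊢
      exact ⟨hT x hx.1, hx.2⟩
    · intro x _ y _ h
      exact inv_injective h
    · intro x hx
      simp only [Finset.mem_filter] at hx
      exact ⟨x⁻¹, by simp [hT x hx.1, hx.2], by simp⟩
  have h3 : (T.filter (fun x => f x ≤ f x⁻¹)).card
      = (T.filter (fun x => f x < f x⁻¹)).card + (T.filter (fun x => x ^ 2 = 1)).card := by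
    rw [← Finset.card_union_of_disjoint]
    · congr 1
      ext x
      have : x ^ 2 = 1 ↔ f x = f x⁻¹ := by
        rw [hf.eq_iff, sq, mul_eq_one_iff_eq_inv]
      simp only [Finset.mem_filter, Finset.mem_union, this, le_iff_lt_or_eq]
      tauto
    · rw [Finset.disjoint_filter]
      intro x _ hx h
      rw [sq, mul_eq_one_iff_eq_inv] at h
      rw [← h] at hx
      exact lt_irrefl _ hx
  omega

open Classical in
theorem aux_count {A : Type*} [CommGroup A] [Fintype A] (T : Finset A)
    (hT : ∀ x ∈ T, x⁻¹ ∈ T) (k : ℕ)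
    (hk : T.card + (T.filter (fun x => x ^ 2 = 1)).card ≤ 2 * k + 1) :
    (Finset.univ.filter (fun S : Set A => S ⊆ T ∧ S⁻¹ = S)).card ≤ 2 ^ k := by
  let e := Fintype.equivFin A
  let f : A → ℕ := fun x => (e x : ℕ)
  have hf : Function.Injective f := fun x y h => e.injective (Fin.ext h)
  have h := aux_half f hf T hT
  have h' : (T.filter (fun x => f x ≤ f x⁻¹)).card ≤ k := by omega
  refine le_trans ?_ (Nat.pow_le_pow_right (by norm_num) h')
  rw [← Finset.card_powerset]
  apply Finset.card_le_card_of_injOn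
    (fun S => (T.filter (fun x => f x ≤ f x⁻¹)).filter (fun x => x ∈ S))
  · intro S _
    exact Finset.mem_coe.2 (Finset.mem_powerset.2 (Finset.filter_subset _ _))
  · intro S hS S' hS' h
    simp only [Finset.coe_filter, Finset.mem_univ, true_and, Set.mem_setOf_eq] at hS hS'
    have key : ∀ S₁ S₂ : Set A, S₁ ⊆ T → S₁⁻¹ = S₁ → S₂⁻¹ = S₂ →
        ((T.filter (fun x => f x ≤ f x⁻¹)).filter (fun x => x ∈ S₁)
          = (T.filter (fun x => f x ≤ f x⁻¹)).filter (fun x => x ∈ S₂)) → S₁ ⊆ S₂ := by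
      intro S₁ S₂ a b c d x hx
      have hx' : x⁻¹ ∈ S₁ := by rw [← b]; simpa using hx
      rcases le_total (f x) (f x⁻¹) with hl | hl
      · have : x ∈ (T.filter (fun x => f x ≤ f x⁻¹)).filter (fun x => x ∈ S₁) := by
          simp only [Finset.mem_filter]
          exact ⟨⟨a hx, hl⟩, hx⟩
        rw [d] at this
        exact (Finset.mem_filter.1 this).2
      · have : x⁻¹ ∈ (T.filter (fun x => f x ≤ f x⁻¹)).filter (fun x => x ∈ S₁) := by
          simp only [Finset.mem_filter, inv_inv]
          exact ⟨⟨a hx', hl⟩, hx'⟩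
        rw [d] at this
        have := (Finset.mem_filter.1 this).2
        rw [← c]; exact this
    exact Set.Subset.antisymm (key _ _ hS.1 hS.2 hS'.2 h) (key _ _ hS'.1 hS'.2 hS.2 h.symm)

theorem aux_char {A : Type*} [CommGroup A] [Finite A] (M : Subgroup A) (hM : IsCoatom M) :
    ∃ χ : A →* ℂˣ, χ.ker = M := by
  obtain ⟨a, ha⟩ : ∃ a, a ∉ M := by
    by_contra! h
    exact hM.1 (eq_top_iff.2 fun x _ => h x)
  have hne : (QuotientGroup.mk a : A ⧸ M) ≠ 1 := by
    rwa [Ne, QuotientGroup.eq_one_iff]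
  have : NeZero (Monoid.exponent (A ⧸ M)) := ⟨Monoid.exponent_ne_zero_of_finite⟩
  obtain ⟨φ, hφ⟩ := CommGroup.exists_apply_ne_one_of_hasEnoughRootsOfUnity (A ⧸ M) ℂ hne
  refine ⟨φ.comp (QuotientGroup.mk' M), ?_⟩
  have hle : M ≤ (φ.comp (QuotientGroup.mk' M)).ker := by
    intro x hx
    rw [MonoidHom.mem_ker]
    simp [(QuotientGroup.eq_one_iff x).2 hx]
  refine (hM.le_iff.1 hle).resolve_left fun h => hφ ?_
  have : a ∈ (φ.comp (QuotientGroup.mk' M)).ker := by rw [h]; trivial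
  simpa [MonoidHom.mem_ker] using this

open Classical in
theorem aux_coatoms (A : Type*) [CommGroup A] [Finite A] :
    Nat.card {M : Subgroup A // IsCoatom M} ≤ Nat.card A := by
  have : NeZero (Monoid.exponent A) := ⟨Monoid.exponent_ne_zero_of_finite⟩
  have hc : Nat.card (A →* ℂˣ) = Nat.card A :=
    Nat.card_congr (CommGroup.monoidHom_mulEquiv_of_hasEnoughRootsOfUnity A ℂ).some.toEquiv
  have : Finite (A →* ℂˣ) := Nat.finite_of_card_ne_zero (by rw [hc]; exact Nat.card_pos.ne')
  rw [← hc]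
  choose χ hχ using fun M : {M : Subgroup A // IsCoatom M} => aux_char M.1 M.2
  refine Nat.card_le_card_of_injective χ fun M N h => Subtype.ext ?_
  rw [← hχ M, ← hχ N, h]

open Classical in
theorem aux_card {A : Type*} [CommGroup A] [Fintype A] (B M : Subgroup A) (hB : B.index = 2)
    (hM : M ≠ ⊤) : 4 * (Finset.univ.filter (fun x => x ∈ M ∧ x ∉ B)).card ≤ Nat.card A := by
  by_cases hMB : M ≤ B
  · rw [Finset.filter_false_of_mem]
    · simp
    · rintro x - ⟨h1, h2⟩
      exact h2 (hMB h1)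
  have h1 : B.relIndex M = 2 := by
    have := Subgroup.relIndex_dvd_index_of_normal B M
    rw [hB, Nat.dvd_prime Nat.prime_two, Subgroup.relIndex_eq_one] at this
    exact this.resolve_left hMB
  have h2 := Subgroup.card_mul_index (B.subgroupOf M)
  have h2' : Nat.card (B.subgroupOf M) * 2 = Nat.card M := by rw [← h1]; exact h2
  have h3 := Subgroup.card_mul_index M
  have h4 : M.index ≠ 1 := fun h => hM (Subgroup.index_eq_one.1 h)
  have h5 : M.index ≠ 0 := Subgroup.index_ne_zero_of_finite
  have h6 : 2 * Nat.card M ≤ Nat.card A := by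
    rw [← h3, mul_comm]; exact Nat.mul_le_mul_left _ (by omega)
  have h7 := Finset.card_filter_add_card_filter_not (s := Finset.univ.filter (fun x => x ∈ M))
    (fun x => x ∈ B)
  rw [Finset.filter_filter, Finset.filter_filter] at h7
  have h8 : (Finset.univ.filter (fun x => x ∈ M)).card = Nat.card M := by
    rw [Nat.card_eq_fintype_card]
    exact (Fintype.card_subtype _).symm
  have h9 : (Finset.univ.filter (fun x => x ∈ M ∧ x ∈ B)).card = Nat.card (B.subgroupOf M) := by
    have e : Nat.card (B.subgroupOf M) = Nat.card {x // x ∈ M ∧ x ∈ B} := 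
      Nat.card_congr (Equiv.subtypeSubtypeEquivSubtypeInter (fun x => x ∈ M) (fun x => x ∈ B))
    rw [e, Nat.card_eq_fintype_card]
    exact (Fintype.card_subtype _).symm
  omega

open Classical in
theorem aux_main (A : Type*) [CommGroup A] [Fintype A] (B : Subgroup A) (hB : B.index = 2) :
    Nat.card {S : Set A | S ⊆ (B : Set A)ᶜ ∧ S⁻¹ = S ∧ Subgroup.closure S ≠ ⊤} ≤
      Nat.card A * 2 ^ ((Nat.card A + 4 * ({a : A | a ^ 2 = 1} \ (B : Set A)).ncard) / 8) := by
  set k := (Nat.card A + 4 * ({a : A | a ^ 2 = 1} \ (B : Set A)).ncard) / 8 with hk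
  have hsub : Nat.card {S : Set A | S ⊆ (B : Set A)ᶜ ∧ S⁻¹ = S ∧ Subgroup.closure S ≠ ⊤} =
      (Finset.univ.filter
        (fun S : Set A => S ⊆ (B : Set A)ᶜ ∧ S⁻¹ = S ∧ Subgroup.closure S ≠ ⊤)).card := by
    rw [Nat.card_eq_fintype_card]
    exact Fintype.card_subtype _
  rw [hsub]
  have hco : (Finset.univ.filter (fun M : Subgroup A => IsCoatom M)).card ≤ Nat.card A := by
    refine le_trans (le_of_eq ?_) (aux_coatoms A)
    rw [Nat.card_eq_fintype_card]
    exact (Fintype.card_subtype _).symm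
  refine le_trans (Finset.card_le_card (t := (Finset.univ.filter
    (fun M : Subgroup A => IsCoatom M)).biUnion (fun M => Finset.univ.filter (fun S : Set A =>
      S ⊆ (Finset.univ.filter (fun x => x ∈ M ∧ x ∉ B) : Finset A) ∧ S⁻¹ = S))) ?_)
    (le_trans (Finset.card_biUnion_le_card_mul _ _ (2 ^ k) ?_) (Nat.mul_le_mul_right _ hco))
  · intro S hS
    simp only [Finset.mem_filter, Finset.mem_univ, true_and, Finset.mem_biUnion] at hS ⊢
    obtain ⟨M, hM, hle⟩ := (eq_top_or_exists_le_coatom (Subgroup.closure S)).resolve_left hS.2.2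
    refine ⟨M, hM, ?_, hS.2.1⟩
    intro x hx
    simp only [Finset.coe_filter, Finset.mem_univ, true_and, Set.mem_setOf_eq]
    exact ⟨hle (Subgroup.subset_closure hx), hS.1 hx⟩
  · intro M hM
    simp only [Finset.mem_filter, Finset.mem_univ, true_and] at hM
    apply aux_count
    · intro x hx
      simpa using hx
    · have h1 := aux_card B M hB hM.1
      have h2 : ((Finset.univ.filter (fun x => x ∈ M ∧ x ∉ B)).filter
          (fun x => x ^ 2 = 1)).card ≤ ({a : A | a ^ 2 = 1} \ (B : Set A)).ncard := by
        rw [← Set.ncard_coe_finset]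
        apply Set.ncard_le_ncard _ (Set.toFinite _)
        intro x hx
        simp only [Finset.coe_filter, Finset.mem_filter, Finset.mem_univ, true_and,
          Set.mem_setOf_eq] at hx
        exact ⟨hx.2, hx.1.2⟩
      omega

/-- Let `A` be a finite abelian group and `B` a subgroup of index 2. The number of
inverse-closed subsets `S` of `A \ B` with `⟨S⟩` a proper subgroup of `A` is at most
`2 ^ (|A|/8 + |A₂ \ B|/2 + log₂ |A|)`. -/
theorem stmt_9 (A : Type*) [CommGroup A] [Finite A] (B : Subgroup A) (hB : B.index = 2) :
    (Nat.card {S : Set A | S ⊆ (B : Set A)ᶜ ∧ S⁻¹ = S ∧ Subgroup.closure S ≠ ⊤} : ℝ) ≤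
      (2 : ℝ) ^ ((Nat.card A : ℝ) / 8 +
        (({a : A | a ^ 2 = 1} \ (B : Set A)).ncard : ℝ) / 2 +
        Real.logb 2 (Nat.card A)) := by
  have := Fintype.ofFinite A
  have hpos : (0 : ℝ) < Nat.card A := by exact_mod_cast Nat.card_pos
  rw [Real.rpow_add (by norm_num), Real.rpow_logb (by norm_num) (by norm_num) hpos, mul_comm]
  have h := aux_main A B hB
  have h' : (Nat.card {S : Set A | S ⊆ (B : Set A)ᶜ ∧ S⁻¹ = S ∧ Subgroup.closure S ≠ ⊤} : ℝ) ≤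
      Nat.card A * 2 ^ ((Nat.card A + 4 * ({a : A | a ^ 2 = 1} \ (B : Set A)).ncard) / 8) := by
    exact_mod_cast h
  refine le_trans h' (mul_le_mul_of_nonneg_left ?_ hpos.le)
  rw [← Real.rpow_natCast]
  apply Real.rpow_le_rpow_of_exponent_le (by norm_num)
  refine le_trans Nat.cast_div_le ?_
  push_cast
  linarith
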